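/- Let b, c, d, e, g ∈ ℂ with e, g, 1+e−g, 2−g all not equal to a nonpositive integer. Then the function u(x,y) = y^{1−g} · F2(b, c, 1+d−g; 1+e−g; 2−g; x, y), where y^{1−g} = exp((1−g)·log y) for y > 0, satisfies at every point of D = {(x,y) ∈ ℝ² : 0 < x < 1, 0 < y} the third-order partial differential equation y²·u_yyy + xy·u_xyy + gx·u_xy + (e+g+1)y·u_yy + (eg − y)·u_y − d·u = 0. -/

import Mathlib

noncomputable def poch (a : ℂ) (n : ℕ) : ℂ := ∏ i ∈ Finset.range n, (a + i)

noncomputable def pdx (u : ℝ → ℝ → ℂ) : ℝ → ℝ → ℂ := fun x y => deriv (fun t => u t y) x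
noncomputable def pdy (u : ℝ → ℝ → ℂ) : ℝ → ℝ → ℂ := fun x y => deriv (fun t => u x t) y

/-- Kampé de Fériet function of the third order. -/
noncomputable def F2 (b c d e g x y : ℂ) : ℂ :=
  ∑' p : ℕ × ℕ,
    poch b p.1 * poch c p.1 * poch d p.2 /
      (poch e (p.1 + p.2) * poch g p.2 * (Nat.factorial p.1 : ℂ) * (Nat.factorial p.2 : ℂ)) *
      x ^ p.1 * y ^ p.2

open Filter Topology

/-- A nonnegative sequence whose consecutive ratios are eventually at most `q` is `O(q ^ n)`. -/
lemma exists_le_mul_pow_of_ratio_le {f : ℕ → ℝ} (hf : ∀ n, 0 ≤ f n) {q : ℝ} (hq : 1 ≤ q)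
    (h : ∀ᶠ n in atTop, f (n + 1) ≤ q * f n) : ∃ C, 0 ≤ C ∧ ∀ n, f n ≤ C * q ^ n := by
  obtain ⟨N, hN⟩ := eventually_atTop.1 h
  have hC : 0 ≤ ∑ i ∈ Finset.range (N + 1), f i := Finset.sum_nonneg fun i _ => hf i
  refine ⟨_, hC, fun n => ?_⟩
  rcases le_total n N with hn | hn
  · calc f n ≤ ∑ i ∈ Finset.range (N + 1), f i :=
          Finset.single_le_sum (fun i _ => hf i) (Finset.mem_range.2 (by omega))
      _ ≤ _ := le_mul_of_one_le_right hC (one_le_pow₀ hq)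
  · induction n, hn using Nat.le_induction with
    | base =>
      calc f N ≤ ∑ i ∈ Finset.range (N + 1), f i :=
            Finset.single_le_sum (fun i _ => hf i) (Finset.mem_range.2 (by omega))
        _ ≤ _ := le_mul_of_one_le_right hC (one_le_pow₀ hq)
    | succ n hn ih =>
      calc f (n + 1) ≤ q * f n := hN n hn
        _ ≤ q * ((∑ i ∈ Finset.range (N + 1), f i) * q ^ n) := by gcongr
        _ = _ := by ring

lemma poch_succ (a : ℂ) (n : ℕ) : poch a (n + 1) = poch a n * (a + n) :=
  Finset.prod_range_succ _ _

lemma poch_ne_zero {a : ℂ} (ha : ∀ n : ℕ, a ≠ -(n : ℂ)) (n : ℕ) : poch a n ≠ 0 :=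
  Finset.prod_ne_zero_iff.2 fun i _ h => ha i (eq_neg_of_add_eq_zero_left h)

lemma exists_norm_poch_le (a : ℂ) {q : ℝ} (hq : 1 < q) :
    ∃ C, 0 ≤ C ∧ ∀ n, ‖poch a n‖ ≤ C * q ^ n * n.factorial := by
  obtain ⟨C, hC, h⟩ := exists_le_mul_pow_of_ratio_le
    (f := fun n => ‖poch a n‖ / n.factorial) (fun n => by positivity) hq.le (by
      obtain ⟨N, hN⟩ := exists_nat_gt (‖a‖ / (q - 1))
      filter_upwards [eventually_ge_atTop N] with n hn
      have hn' : (N : ℝ) ≤ n := by exact_mod_cast hn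
      have h1 : ‖a‖ < n * (q - 1) := (div_lt_iff₀ (by linarith)).1 (by linarith)
      have h2 : ‖a + n‖ ≤ q * (n + 1) := by
        calc ‖a + n‖ ≤ ‖a‖ + ‖(n : ℂ)‖ := norm_add_le _ _
          _ = ‖a‖ + n := by simp
          _ ≤ _ := by nlinarith
      rw [poch_succ, norm_mul, Nat.factorial_succ, Nat.cast_mul, div_le_iff₀ (by positivity)]
      calc ‖poch a n‖ * ‖a + n‖ ≤ ‖poch a n‖ * (q * (n + 1)) := by gcongr
        _ = _ := by push_cast; field_simp)
  exact ⟨C, hC, fun n => (div_le_iff₀ (by positivity)).1 (h n)⟩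

lemma exists_factorial_le_norm_poch {a : ℂ} (ha : ∀ n : ℕ, a ≠ -(n : ℂ)) {q : ℝ} (hq : 1 < q) :
    ∃ C, 0 ≤ C ∧ ∀ n, (n.factorial : ℝ) ≤ C * q ^ n * ‖poch a n‖ := by
  have hpos : ∀ n, 0 < ‖poch a n‖ := fun n => norm_pos_iff.2 (poch_ne_zero ha n)
  obtain ⟨C, hC, h⟩ := exists_le_mul_pow_of_ratio_le
    (f := fun n => n.factorial / ‖poch a n‖) (fun n => by positivity) hq.le (by
      obtain ⟨N, hN⟩ := exists_nat_gt ((1 + q * ‖a‖) / (q - 1))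
      filter_upwards [eventually_ge_atTop N] with n hn
      have hn' : (N : ℝ) ≤ n := by exact_mod_cast hn
      have h1 : 1 + q * ‖a‖ < n * (q - 1) := (div_lt_iff₀ (by linarith)).1 (by linarith)
      have h2 : (n : ℝ) + 1 ≤ q * ‖a + n‖ := by
        have h3 : (n : ℝ) ≤ ‖a + n‖ + ‖a‖ := by
          calc (n : ℝ) = ‖(a + n) - a‖ := by simp
            _ ≤ _ := norm_sub_le _ _
        nlinarith
      have h4 := hpos (n + 1)
      have h5 := hpos n
      rw [div_le_iff₀ h4, poch_succ, norm_mul, Nat.factorial_succ, Nat.cast_mul]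
      calc ((n + 1 : ℕ) : ℝ) * n.factorial ≤ (q * ‖a + n‖) * n.factorial := by
            push_cast; gcongr
        _ = _ := by field_simp)
  exact ⟨C, hC, fun n => (div_le_iff₀ (hpos n)).1 (h n)⟩

/-- The coefficients of the double series `F2`. -/
noncomputable def kampeCoeff (b c d e g : ℂ) (p : ℕ × ℕ) : ℂ :=
  poch b p.1 * poch c p.1 * poch d p.2 /
    (poch e (p.1 + p.2) * poch g p.2 * (Nat.factorial p.1 : ℂ) * (Nat.factorial p.2 : ℂ))

/-- Coefficients of a double power series converging for `‖x‖ < 1` and all `y`. -/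
def IsAdmissible (a : ℕ × ℕ → ℂ) : Prop :=
  ∀ r R : ℝ, 0 < r → r < 1 → 0 < R → ∃ C, ∀ p, ‖a p‖ * r ^ p.1 * R ^ p.2 ≤ C

lemma isAdmissible_kampeCoeff (b c d : ℂ) {e g : ℂ} (he : ∀ n : ℕ, e ≠ -(n : ℂ))
    (hg : ∀ n : ℕ, g ≠ -(n : ℂ)) : IsAdmissible (kampeCoeff b c d e g) := by
  intro r R hr0 hr1 hR
  obtain ⟨q, hq1, hqr⟩ : ∃ q : ℝ, 1 < q ∧ q ^ 3 * r < 1 := by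
    have h1 : Tendsto (fun q : ℝ => q ^ 3 * r) (𝓝[>] 1) (𝓝 (1 ^ 3 * r)) :=
      (Continuous.tendsto (by fun_prop) _).mono_left nhdsWithin_le_nhds
    have h2 := h1.eventually_lt_const (u := 1) (by linarith)
    obtain ⟨q, hq, hq'⟩ := (h2.and self_mem_nhdsWithin).exists
    exact ⟨q, hq', hq⟩
  have hq0 : 0 < q := by linarith
  obtain ⟨B, hB, hb⟩ := exists_norm_poch_le b hq1
  obtain ⟨C, hC, hc⟩ := exists_norm_poch_le c hq1
  obtain ⟨D, hD, hd⟩ := exists_norm_poch_le d hq1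
  obtain ⟨E, hE, hee⟩ := exists_factorial_le_norm_poch he hq1
  obtain ⟨G, hG, hgg⟩ := exists_factorial_le_norm_poch hg hq1
  refine ⟨B * C * D * E * G * Real.exp (q ^ 3 * R), ?_⟩
  rintro ⟨m, n⟩
  have hpe : 0 < ‖poch e (m + n)‖ := norm_pos_iff.2 (poch_ne_zero he _)
  have hpg : 0 < ‖poch g n‖ := norm_pos_iff.2 (poch_ne_zero hg _)
  have hfac : (m.factorial : ℝ) * n.factorial ≤ E * q ^ (m + n) * ‖poch e (m + n)‖ :=
    le_trans (by
      exact_mod_cast Nat.le_of_dvd (Nat.factorial_pos _)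
        (Nat.factorial_mul_factorial_dvd_factorial_add m n))
      (hee (m + n))
  have key : ‖kampeCoeff b c d e g (m, n)‖ ≤
      B * C * D * E * G * (q ^ 3) ^ m * ((q ^ 3) ^ n / n.factorial) := by
    simp only [kampeCoeff, norm_div, norm_mul, Complex.norm_natCast]
    rw [div_le_iff₀ (by positivity)]
    calc ‖poch b m‖ * ‖poch c m‖ * ‖poch d n‖
        ≤ (B * q ^ m * m.factorial) * (C * q ^ m * m.factorial) * (D * q ^ n * n.factorial) := by
          gcongr
          exacts [hb m, hc m, hd n]
      _ = B * C * D * q ^ m * q ^ m * q ^ n * m.factorial * (m.factorial * n.factorial) := by ring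
      _ ≤ B * C * D * q ^ m * q ^ m * q ^ n * m.factorial *
            (E * q ^ (m + n) * ‖poch e (m + n)‖) := by gcongr
      _ ≤ B * C * D * q ^ m * q ^ m * q ^ n * m.factorial *
            (E * q ^ (m + n) * ‖poch e (m + n)‖) * (G * q ^ n * ‖poch g n‖) :=
          le_mul_of_one_le_right (by positivity)
            (le_trans (by exact_mod_cast n.factorial_pos) (hgg n))
      _ = _ := by
          field_simp
          ring
  calc ‖kampeCoeff b c d e g (m, n)‖ * r ^ m * R ^ n
      ≤ B * C * D * E * G * (q ^ 3) ^ m * ((q ^ 3) ^ n / n.factorial) * r ^ m * R ^ n := by gcongr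
    _ = B * C * D * E * G * (q ^ 3 * r) ^ m * ((q ^ 3 * R) ^ n / n.factorial) := by
        rw [mul_pow, mul_pow]; ring
    _ ≤ B * C * D * E * G * 1 * Real.exp (q ^ 3 * R) := by
        gcongr
        · exact pow_le_one₀ (by positivity) hqr.le
        · exact Real.pow_div_factorial_le_exp _ (by positivity) n
    _ = _ := by ring

lemma IsAdmissible.summable {a : ℕ × ℕ → ℂ} (ha : IsAdmissible a) (i j : ℕ) {r R : ℝ}
    (hr0 : 0 < r) (hr1 : r < 1) (hR : 0 < R) :
    Summable fun p : ℕ × ℕ =>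
      ‖a p‖ * ((p.1 : ℝ) ^ i * r ^ p.1) * ((p.2 : ℝ) ^ j * R ^ p.2) := by
  obtain ⟨s, hrs, hs1⟩ := exists_between hr1
  have hs0 : 0 < s := hr0.trans hrs
  obtain ⟨C, hC⟩ := ha s (2 * R) hs0 hs1 (by positivity)
  have h1 : Summable fun m : ℕ => (m : ℝ) ^ i * (r / s) ^ m :=
    summable_pow_mul_geometric_of_norm_lt_one i (by
      rw [Real.norm_of_nonneg (by positivity)]; exact (div_lt_one hs0).2 hrs)
  have h2 : Summable fun n : ℕ => (n : ℝ) ^ j * (1 / 2 : ℝ) ^ n :=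
    summable_pow_mul_geometric_of_norm_lt_one j (by norm_num)
  have h3 := (h1.mul_of_nonneg h2 (fun _ => by positivity) (fun _ => by positivity)).mul_left C
  refine Summable.of_nonneg_of_le (fun p => by positivity) (fun p => ?_) h3
  calc ‖a p‖ * ((p.1 : ℝ) ^ i * r ^ p.1) * ((p.2 : ℝ) ^ j * R ^ p.2)
      = (‖a p‖ * s ^ p.1 * (2 * R) ^ p.2) *
          (((p.1 : ℝ) ^ i * (r / s) ^ p.1) * ((p.2 : ℝ) ^ j * (1 / 2 : ℝ) ^ p.2)) := by
        have h4 : r ^ p.1 = s ^ p.1 * (r / s) ^ p.1 := by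
          rw [← mul_pow, mul_div_cancel₀ _ hs0.ne']
        have h5 : R ^ p.2 = (2 * R) ^ p.2 * (1 / 2 : ℝ) ^ p.2 := by
          rw [← mul_pow]; congr 1; ring
        rw [h4, h5]; ring
    _ ≤ _ := by gcongr; exact hC p

/-- The term of index `p` of the `(i, j)`-th partial derivative of a double power series. -/
noncomputable def seriesTerm (a : ℕ × ℕ → ℂ) (i j : ℕ) (x y : ℂ) (p : ℕ × ℕ) : ℂ :=
  a p * ((p.1.descFactorial i : ℂ) * x ^ (p.1 - i)) * ((p.2.descFactorial j : ℂ) * y ^ (p.2 - j))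

/-- The `(i, j)`-th partial derivative of a double power series. -/
noncomputable def seriesSum (a : ℕ × ℕ → ℂ) (i j : ℕ) (x y : ℂ) : ℂ :=
  ∑' p, seriesTerm a i j x y p

lemma norm_descFactorial_mul_pow_le (m i : ℕ) {x : ℂ} {r : ℝ} (hr : 0 < r) (hx : ‖x‖ ≤ r) :
    ‖(m.descFactorial i : ℂ) * x ^ (m - i)‖ ≤ ((m : ℝ) ^ i * r ^ m) * (r ^ i)⁻¹ := by
  rcases lt_or_ge m i with h | h
  · rw [Nat.descFactorial_of_lt h]
    simp only [Nat.cast_zero, zero_mul, norm_zero]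
    positivity
  · have h1 : (m.descFactorial i : ℝ) ≤ (m : ℝ) ^ i := by
      exact_mod_cast Nat.descFactorial_le_pow m i
    rw [norm_mul, norm_pow, Complex.norm_natCast, mul_assoc, ← pow_sub₀ r hr.ne' h]
    gcongr

lemma norm_seriesTerm_le (a : ℕ × ℕ → ℂ) (i j : ℕ) {x y : ℂ} {r R : ℝ} (hr : 0 < r)
    (hR : 0 < R) (hx : ‖x‖ ≤ r) (hy : ‖y‖ ≤ R) (p : ℕ × ℕ) :
    ‖seriesTerm a i j x y p‖ ≤
      ‖a p‖ * ((p.1 : ℝ) ^ i * r ^ p.1) * ((p.2 : ℝ) ^ j * R ^ p.2) * ((r ^ i)⁻¹ * (R ^ j)⁻¹) := by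
  rw [seriesTerm, norm_mul, norm_mul]
  calc _ ≤ ‖a p‖ * (((p.1 : ℝ) ^ i * r ^ p.1) * (r ^ i)⁻¹) *
        (((p.2 : ℝ) ^ j * R ^ p.2) * (R ^ j)⁻¹) := by
        gcongr
        · exact norm_descFactorial_mul_pow_le _ _ hr hx
        · exact norm_descFactorial_mul_pow_le _ _ hR hy
    _ = _ := by ring

lemma exists_radius {x : ℂ} (hx : ‖x‖ < 1) : ∃ r : ℝ, 0 < r ∧ r < 1 ∧ ‖x‖ < r := by
  obtain ⟨r, h1, h2⟩ := exists_between hx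
  exact ⟨r, (norm_nonneg x).trans_lt h1, h2, h1⟩

lemma IsAdmissible.hasSum {a : ℕ × ℕ → ℂ} (ha : IsAdmissible a) (i j : ℕ) {x : ℂ}
    (hx : ‖x‖ < 1) (y : ℂ) : HasSum (seriesTerm a i j x y) (seriesSum a i j x y) := by
  obtain ⟨r, hr0, hr1, hxr⟩ := exists_radius hx
  have hR : 0 < ‖y‖ + 1 := by positivity
  exact (Summable.of_norm_bounded ((ha.summable i j hr0 hr1 hR).mul_right _)
    (norm_seriesTerm_le a i j hr0 hR hxr.le (by linarith))).hasSum

lemma hasDerivAt_descFactorial_mul_pow (m i : ℕ) (x : ℂ) :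
    HasDerivAt (fun t : ℂ => (m.descFactorial i : ℂ) * t ^ (m - i))
      ((m.descFactorial (i + 1) : ℂ) * x ^ (m - (i + 1))) x := by
  refine ((hasDerivAt_pow (m - i) x).const_mul (m.descFactorial i : ℂ)).congr_deriv ?_
  rw [Nat.descFactorial_succ, Nat.cast_mul, Nat.sub_sub]
  ring

lemma IsAdmissible.hasDerivAt_fst {a : ℕ × ℕ → ℂ} (ha : IsAdmissible a) (i j : ℕ) {x : ℂ}
    (hx : ‖x‖ < 1) (y : ℂ) :
    HasDerivAt (fun t => seriesSum a i j t y) (seriesSum a (i + 1) j x y) x := by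
  obtain ⟨r, hr0, hr1, hxr⟩ := exists_radius hx
  have hR : 0 < ‖y‖ + 1 := by positivity
  refine hasDerivAt_tsum_of_isPreconnected (t := Metric.ball 0 r) (y₀ := x)
    (g := fun p t => seriesTerm a i j t y p) (g' := fun p t => seriesTerm a (i + 1) j t y p)
    ((ha.summable (i + 1) j hr0 hr1 hR).mul_right ((r ^ (i + 1))⁻¹ * ((‖y‖ + 1) ^ j)⁻¹)) Metric.isOpen_ball
    (convex_ball _ _).isPreconnected (fun p t _ => ?_) (fun p t ht => ?_) (by simpa using hxr)
    (ha.hasSum i j hx y).summable (by simpa using hxr)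
  · exact ((hasDerivAt_descFactorial_mul_pow p.1 i t).const_mul (a p)).mul_const _
  · exact norm_seriesTerm_le a (i + 1) j hr0 hR (le_of_lt (by simpa using ht)) (by linarith) p

lemma IsAdmissible.hasDerivAt_snd {a : ℕ × ℕ → ℂ} (ha : IsAdmissible a) (i j : ℕ) {x : ℂ}
    (hx : ‖x‖ < 1) (y : ℂ) :
    HasDerivAt (fun t => seriesSum a i j x t) (seriesSum a i (j + 1) x y) y := by
  obtain ⟨r, hr0, hr1, hxr⟩ := exists_radius hx
  have hR : 0 < ‖y‖ + 1 := by positivity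
  refine hasDerivAt_tsum_of_isPreconnected (t := Metric.ball 0 (‖y‖ + 1)) (y₀ := y)
    (g := fun p t => seriesTerm a i j x t p) (g' := fun p t => seriesTerm a i (j + 1) x t p)
    ((ha.summable i (j + 1) hr0 hr1 hR).mul_right ((r ^ i)⁻¹ * ((‖y‖ + 1) ^ (j + 1))⁻¹)) Metric.isOpen_ball
    (convex_ball _ _).isPreconnected (fun p t _ => ?_) (fun p t ht => ?_) (by simp)
    (ha.hasSum i j hx y).summable (by simp)
  · exact (hasDerivAt_descFactorial_mul_pow p.2 j t).const_mul _
  · exact norm_seriesTerm_le a i (j + 1) hr0 hR hxr.le (le_of_lt (by simpa using ht)) p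

lemma pow_mul_descFactorial_mul_pow (m i : ℕ) (x : ℂ) :
    x ^ i * ((m.descFactorial i : ℂ) * x ^ (m - i)) = (m.descFactorial i : ℂ) * x ^ m := by
  rcases lt_or_ge m i with h | h
  · simp [Nat.descFactorial_of_lt h]
  · rw [mul_left_comm, ← pow_add, Nat.add_sub_cancel' h]

lemma IsAdmissible.hasSum_pow_mul {a : ℕ × ℕ → ℂ} (ha : IsAdmissible a) (i j : ℕ) {x : ℂ}
    (hx : ‖x‖ < 1) (y : ℂ) :
    HasSum (fun p : ℕ × ℕ => (p.1.descFactorial i : ℂ) * (p.2.descFactorial j : ℂ) *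
      (a p * x ^ p.1 * y ^ p.2)) (x ^ i * y ^ j * seriesSum a i j x y) := by
  refine ((ha.hasSum i j hx y).mul_left (x ^ i * y ^ j)).congr_fun fun p => ?_
  calc _ = a p * ((p.1.descFactorial i : ℂ) * x ^ p.1) *
        ((p.2.descFactorial j : ℂ) * y ^ p.2) := by ring
    _ = _ := by
      rw [← pow_mul_descFactorial_mul_pow, ← pow_mul_descFactorial_mul_pow p.2, seriesTerm]
      ring

lemma cast_descFactorial_two_complex (n : ℕ) : (n.descFactorial 2 : ℂ) = n * (n - 1) := by
  rcases n with _ | n <;> simp [Nat.descFactorial_succ, mul_comm]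

lemma cast_descFactorial_three_complex (n : ℕ) :
    (n.descFactorial 3 : ℂ) = n * (n - 1) * (n - 2) := by
  rcases n with _ | _ | n
  · simp
  · simp [Nat.descFactorial_succ]
  · simp [Nat.descFactorial_succ]
    ring

lemma kampeCoeff_succ (b c d : ℂ) {e g : ℂ} (he : ∀ n : ℕ, e ≠ -(n : ℂ))
    (hg : ∀ n : ℕ, g ≠ -(n : ℂ)) (m n : ℕ) :
    (n + 1) * (g + n) * (e + m + n) * kampeCoeff b c d e g (m, n + 1) =
      (d + n) * kampeCoeff b c d e g (m, n) := by
  have h1 : e + (m + n) ≠ 0 := fun h => he (m + n) (by push_cast; linear_combination h)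
  have h2 : g + n ≠ 0 := fun h => hg n (by linear_combination h)
  have h3 := poch_ne_zero he (m + n)
  have h4 := poch_ne_zero hg n
  have h5 : (m.factorial : ℂ) ≠ 0 := by exact_mod_cast m.factorial_ne_zero
  have h6 : (n.factorial : ℂ) ≠ 0 := by exact_mod_cast n.factorial_ne_zero
  have h7 : (n : ℂ) + 1 ≠ 0 := by exact_mod_cast n.succ_ne_zero
  simp only [kampeCoeff, ← add_assoc m n 1, poch_succ, Nat.factorial_succ, Nat.cast_mul,
    Nat.cast_add, Nat.cast_one]
  field_simp
  ring

/-- The third-order equation satisfied by the series `F2` itself. -/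
lemma kampe_pde (b c d : ℂ) {e g : ℂ} (he : ∀ n : ℕ, e ≠ -(n : ℂ))
    (hg : ∀ n : ℕ, g ≠ -(n : ℂ)) {x y : ℂ} (hx : ‖x‖ < 1) (hy : y ≠ 0) :
    y ^ 2 * seriesSum (kampeCoeff b c d e g) 0 3 x y
      + x * y * seriesSum (kampeCoeff b c d e g) 1 2 x y
      + g * x * seriesSum (kampeCoeff b c d e g) 1 1 x y
      + (e + g + 1) * y * seriesSum (kampeCoeff b c d e g) 0 2 x y
      + (e * g - y) * seriesSum (kampeCoeff b c d e g) 0 1 x y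
      - d * seriesSum (kampeCoeff b c d e g) 0 0 x y = 0 := by
  have ha := isAdmissible_kampeCoeff b c d he hg
  have H := fun i j => ha.hasSum_pow_mul i j hx y
  have hA := ((((H 0 3).add (H 1 2)).add ((H 1 1).mul_left g)).add
    ((H 0 2).mul_left (e + g + 1))).add ((H 0 1).mul_left (e * g))
  have hB := ((H 0 1).add ((H 0 0).mul_left d)).mul_left y
  have hinj : Function.Injective fun p : ℕ × ℕ => (p.1, p.2 + 1) := by
    rintro ⟨m, n⟩ ⟨m', n'⟩ h
    simpa using h
  rw [← hinj.hasSum_iff] at hA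
  · have hAB := hA.unique (hB.congr_fun fun ⟨m, n⟩ => by
      have hk := kampeCoeff_succ b c d he hg m n
      simp only [Function.comp_apply, cast_descFactorial_two_complex,
        cast_descFactorial_three_complex, Nat.descFactorial_zero, Nat.descFactorial_one,
        Nat.cast_add, Nat.cast_one]
      linear_combination (x ^ m * y ^ (n + 1)) * hk)
    apply mul_left_cancel₀ hy
    linear_combination hAB
  · rintro ⟨m, n⟩ hn
    rcases n with _ | n
    · simp
    · exact absurd ⟨(m, n), rfl⟩ hn

lemma hasDerivAt_exp_mul_log (κ : ℂ) {y : ℝ} (hy : 0 < y) :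
    HasDerivAt (fun t : ℝ => Complex.exp (κ * (Real.log t : ℂ)))
      (Complex.exp (κ * (Real.log y : ℂ)) * (κ / y)) y := by
  refine ((Real.hasDerivAt_log hy.ne').ofReal_comp.const_mul κ).cexp.congr_deriv ?_
  push_cast
  ring

/-- Product rule for `y ^ κ * h y` on the positive half-line. -/
lemma deriv_exp_mul_log_mul {κ : ℂ} {f h : ℝ → ℂ} {h' : ℂ} {y : ℝ} (hy : 0 < y)
    (hf : ∀ t : ℝ, 0 < t → f t = Complex.exp (κ * (Real.log t : ℂ)) * h t)
    (hh : HasDerivAt h h' y) :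
    deriv f y = Complex.exp (κ * (Real.log y : ℂ)) * (κ / y * h y + h') := by
  have h1 : f =ᶠ[𝓝 y] fun t => Complex.exp (κ * (Real.log t : ℂ)) * h t := by
    filter_upwards [eventually_gt_nhds hy] with t ht using hf t ht
  rw [h1.deriv_eq]
  refine ((hasDerivAt_exp_mul_log κ hy).mul hh).deriv.trans ?_
  ring

lemma hasDerivAt_const_div_ofReal (κ : ℂ) {y : ℝ} (hy : 0 < y) :
    HasDerivAt (fun t : ℝ => κ / (t : ℂ)) (-κ / (y : ℂ) ^ 2) y := by
  have hy' : (y : ℂ) ≠ 0 := by exact_mod_cast hy.ne'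
  refine ((hasDerivAt_inv hy').comp_ofReal.const_mul κ).congr_deriv ?_
  field_simp

theorem stmt7 (b c d e g : ℂ)
    (he : ∀ n : ℕ, e ≠ -(n : ℂ)) (hg : ∀ n : ℕ, g ≠ -(n : ℂ))
    (he' : ∀ n : ℕ, (1 + e - g) ≠ -(n : ℂ)) (hg' : ∀ n : ℕ, (2 - g) ≠ -(n : ℂ))
    (u : ℝ → ℝ → ℂ)
    (hu : u = fun x y : ℝ => Complex.exp ((1 - g) * (Real.log y : ℂ)) * F2 b c (1 + d - g) (1 + e - g) (2 - g) (x : ℂ) (y : ℂ)) :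
    ∀ x y : ℝ, 0 < x → x < 1 → 0 < y →
      (y : ℂ) ^ 2 * pdy (pdy (pdy u)) x y + (x : ℂ) * (y : ℂ) * pdy (pdy (pdx u)) x y
        + g * (x : ℂ) * pdy (pdx u) x y + (e + g + 1) * (y : ℂ) * pdy (pdy u) x y
        + (e * g - (y : ℂ)) * pdy u x y - d * u x y = 0 := by
  intro x y hx0 hx1 hy
  set a := kampeCoeff b c (1 + d - g) (1 + e - g) (2 - g) with ha_def
  have ha : IsAdmissible a := isAdmissible_kampeCoeff b c _ he' hg'
  set κ : ℂ := 1 - g with hκ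
  have hx : ‖(x : ℂ)‖ < 1 := by simpa [abs_of_pos hx0] using hx1
  set S : ℕ → ℕ → ℝ → ℂ := fun i j t => seriesSum a i j x t with hS
  have dS : ∀ i j (t : ℝ), HasDerivAt (S i j) (S i (j + 1) t) t := fun i j t =>
    (ha.hasDerivAt_snd i j hx t).comp_ofReal
  have hu' : ∀ s t : ℝ,
      u s t = Complex.exp (κ * (Real.log t : ℂ)) * seriesSum a 0 0 s t := by
    intro s t
    rw [hu]
    simp only [F2, seriesSum, seriesTerm, ha_def, kampeCoeff, Nat.descFactorial_zero,
      Nat.cast_one, one_mul, Nat.sub_zero]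
  have dκ : ∀ t : ℝ, 0 < t → HasDerivAt (fun t : ℝ => κ / (t : ℂ)) (-κ / (t : ℂ) ^ 2) t :=
    fun t ht => hasDerivAt_const_div_ofReal κ ht
  have dκ₂ : ∀ t : ℝ, 0 < t →
      HasDerivAt (fun t : ℝ => -κ / (t : ℂ) ^ 2) (2 * κ / (t : ℂ) ^ 3) t := by
    intro t ht
    have ht' : (t : ℂ) ≠ 0 := by exact_mod_cast ht.ne'
    refine (((hasDerivAt_pow 2 (t : ℂ)).inv (pow_ne_zero 2 ht')).comp_ofReal.const_mul
      (-κ)).congr_deriv ?_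
    field_simp
    push_cast
    ring
  have first : ∀ i (w : ℝ → ℝ → ℂ),
      (∀ t : ℝ, 0 < t → w x t = Complex.exp (κ * (Real.log t : ℂ)) * S i 0 t) →
      ∀ t : ℝ, 0 < t → pdy w x t =
        Complex.exp (κ * (Real.log t : ℂ)) * (κ / t * S i 0 t + S i 1 t) :=
    fun i w hw t ht => deriv_exp_mul_log_mul ht hw (dS i 0 t)
  have second : ∀ i (w : ℝ → ℝ → ℂ),
      (∀ t : ℝ, 0 < t → w x t = Complex.exp (κ * (Real.log t : ℂ)) * S i 0 t) →
      ∀ t : ℝ, 0 < t → pdy (pdy w) x t = Complex.exp (κ * (Real.log t : ℂ)) *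
        (κ / t * (κ / t * S i 0 t + S i 1 t) +
          (-κ / (t : ℂ) ^ 2 * S i 0 t + κ / t * S i 1 t + S i 2 t)) :=
    fun i w hw t ht => deriv_exp_mul_log_mul ht (first i w hw)
      (((dκ t ht).mul (dS i 0 t)).add (dS i 1 t))
  have hu0 : ∀ t : ℝ, 0 < t → u x t = Complex.exp (κ * (Real.log t : ℂ)) * S 0 0 t :=
    fun t _ => hu' x t
  have hux : ∀ t : ℝ, 0 < t → pdx u x t = Complex.exp (κ * (Real.log t : ℂ)) * S 1 0 t := by
    intro t _
    simp only [pdx, hu']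
    exact ((ha.hasDerivAt_fst 0 0 hx t).comp_ofReal.const_mul _).deriv
  have third : pdy (pdy (pdy u)) x y = _ :=
    deriv_exp_mul_log_mul hy (second 0 u hu0)
      (((dκ y hy).mul (((dκ y hy).mul (dS 0 0 y)).add (dS 0 1 y))).add
        ((((dκ₂ y hy).mul (dS 0 0 y)).add ((dκ y hy).mul (dS 0 1 y))).add (dS 0 2 y)))
  have hy' : (y : ℂ) ≠ 0 := by exact_mod_cast hy.ne'
  have hpde := kampe_pde b c (1 + d - g) he' hg' hx hy'
  rw [third, second 1 _ hux y hy, first 1 _ hux y hy, second 0 u hu0 y hy, first 0 u hu0 y hy,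
    hu0 y hy]
  simp only [Pi.add_apply, Pi.mul_apply, Nat.reduceAdd]
  change _ * S 0 3 y + _ * S 1 2 y + _ * S 1 1 y + _ * S 0 2 y + _ * S 0 1 y - _ * S 0 0 y = 0
    at hpde
  have hg2 : g = 1 - κ := by rw [hκ]; ring
  rw [hg2] at hpde ⊢
  clear_value κ
  field_simp
  linear_combination Complex.exp (κ * (Real.log y : ℂ)) * y * hpde
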